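/- Let Ã be a real symmetric n×n matrix and T an invertible real n×n matrix such that Tᵀ Ã T = Λ is diagonal with diagonal entries λ₁,…,λₙ; set Λ⁺ = diag(max(λᵢ,0)), |Λ⁻| = diag(max(−λᵢ,0)), A⁺ = √Λ⁺ · T⁻¹ and A⁻ = √|Λ⁻| · T⁻¹. Let R be a real n×n matrix with I − RᵀR positive semidefinite. Then for every U ∈ ℝⁿ, the boundary term obtained with the weak homogeneous penalty implementation is nonnegative: Uᵀ Ã U + 2 (A⁻U)ᵀ((A⁻ − R A⁺)U) ≥ 0. -/

import Mathlib

open Matrix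

/-- A matrix `R` with `I - Rᵀ R` positive semidefinite is a contraction for the Euclidean
inner product. -/
theorem dotProduct_mulVec_self_le_of_posSemidef {m n : Type*} [Fintype m] [Fintype n]
    [DecidableEq n] {R : Matrix m n ℝ} (hR : (1 - Rᵀ * R).PosSemidef) (p : n → ℝ) :
    R *ᵥ p ⬝ᵥ R *ᵥ p ≤ p ⬝ᵥ p := by
  have h := hR.dotProduct_mulVec_nonneg p
  rw [star_trivial, sub_mulVec, one_mulVec, dotProduct_sub, ← mulVec_mulVec,
    dotProduct_mulVec p, vecMul_transpose] at h
  linarith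

/-- A diagonal quadratic form is the difference of the squared lengths of its scaled positive and
negative parts. -/
theorem dotProduct_diagonal_mulVec_eq_sub {n : Type*} [Fintype n] [DecidableEq n]
    (d v : n → ℝ) :
    v ⬝ᵥ diagonal d *ᵥ v =
      (diagonal fun i => √(max (d i) 0)) *ᵥ v ⬝ᵥ (diagonal fun i => √(max (d i) 0)) *ᵥ v -
      (diagonal fun i => √(max (-d i) 0)) *ᵥ v ⬝ᵥ (diagonal fun i => √(max (-d i) 0)) *ᵥ v := by
  simp only [dotProduct, mulVec_diagonal, ← Finset.sum_sub_distrib]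
  refine Finset.sum_congr rfl fun i _ => ?_
  have hpos := Real.mul_self_sqrt (le_max_right (d i) 0)
  have hneg := Real.mul_self_sqrt (le_max_right (-d i) 0)
  have hsub : max (d i) 0 - max (-d i) 0 = d i := by
    rcases le_total (d i) 0 with h | h <;> simp [h]
  linear_combination (-(v i) ^ 2) * hsub - (v i) ^ 2 * hpos + (v i) ^ 2 * hneg

/-- weak homogeneous nonlinear boundary conditions give a
nonnegative boundary term when `I − RᵀR ⪰ 0`. -/
theorem weak_homogeneous_bc_nonneg (n : ℕ) (hn : 0 < n)
    (Atil T : Matrix (Fin n) (Fin n) ℝ)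
    (hsym : Atil.IsSymm) (hT : IsUnit T.det)
    (lam : Fin n → ℝ) (hdiag : Tᵀ * Atil * T = Matrix.diagonal lam)
    (R : Matrix (Fin n) (Fin n) ℝ)
    (hR : (1 - Rᵀ * R).PosSemidef)
    (U : Fin n → ℝ) :
    0 ≤ U ⬝ᵥ Atil.mulVec U +
      2 * (((Matrix.diagonal fun i => Real.sqrt (max (-lam i) 0)) * T⁻¹).mulVec U ⬝ᵥ
        ((Matrix.diagonal fun i => Real.sqrt (max (-lam i) 0)) * T⁻¹
          - R * ((Matrix.diagonal fun i => Real.sqrt (max (lam i) 0)) * T⁻¹)).mulVec U) := by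
  have hquad : U ⬝ᵥ Atil *ᵥ U = (T⁻¹ *ᵥ U) ⬝ᵥ diagonal lam *ᵥ (T⁻¹ *ᵥ U) := by
    have hU : T *ᵥ (T⁻¹ *ᵥ U) = U := by
      rw [mulVec_mulVec, mul_nonsing_inv T hT, one_mulVec]
    rw [← hdiag, ← mulVec_mulVec, ← mulVec_mulVec, hU, dotProduct_mulVec _ Tᵀ,
      vecMul_transpose, hU]
  rw [hquad, dotProduct_diagonal_mulVec_eq_sub, sub_mulVec, ← mulVec_mulVec, ← mulVec_mulVec,
    ← mulVec_mulVec]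
  set p := (diagonal fun i => √(max (lam i) 0)) *ᵥ (T⁻¹ *ᵥ U)
  set q := (diagonal fun i => √(max (-lam i) 0)) *ᵥ (T⁻¹ *ᵥ U)
  have hcontr := dotProduct_mulVec_self_le_of_posSemidef hR p
  have hsq : 0 ≤ (q - R *ᵥ p) ⬝ᵥ (q - R *ᵥ p) := by
    simpa using dotProduct_star_self_nonneg (q - R *ᵥ p)
  simp only [dotProduct_sub, sub_dotProduct, dotProduct_comm (R *ᵥ p) q] at hsq ⊢
  linarith
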